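/- arXiv:2604.02014 — 8 statements merged into one kernel-verified Lean document; each statement's English description precedes it below -/
import Mathlib

section
/- Let p be a prime, q = p², and k ≥ 1. Define the polynomial S_{k−1}(y) := Σ_{ℓ=0}^{k−1} ((−1)^ℓ/(p^ℓ·ℓ!))·y^ℓ over ℚ. Then the coefficient of y^k in (S_{k−1}(y))^q equals (−p)^k/k! − q·(−1)^k/(p^k·k!). -/
open PowerSeries in
/-- The first coefficient lost by truncation enters the power of a power series with constant
coefficient `1` linearly. -/
theorem coeff_trunc_pow_self {R : Type*} [CommRing R] (F : R⟦X⟧) (hF : constantCoeff F = 1)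
    {k : ℕ} (hk : k ≠ 0) (n : ℕ) :
    ((trunc k F) ^ n).coeff k = coeff k (F ^ n) - n * coeff k F := by
  obtain ⟨r, hr⟩ := Polynomial.powAddExpansion (trunc k F : R⟦X⟧)
    (X ^ k * mk fun i ↦ coeff (i + k) F) n
  have hT : constantCoeff (trunc k F : R⟦X⟧) = 1 := by
    rw [← coeff_zero_eq_constantCoeff_apply, Polynomial.coeff_coe, coeff_trunc,
      if_pos (Nat.pos_of_ne_zero hk), coeff_zero_eq_constantCoeff_apply, hF]
  have hsplit : F = (trunc k F : R⟦X⟧) + X ^ k * mk fun i ↦ coeff (i + k) F := by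
    rw [add_comm]
    exact eq_X_pow_mul_shift_add_trunc k F
  have hlin : coeff k ((n : R⟦X⟧) * (trunc k F : R⟦X⟧) ^ (n - 1) *
      (X ^ k * mk fun i ↦ coeff (i + k) F))
      = n * coeff k F := by
    rw [mul_left_comm, coeff_X_pow_mul', if_pos le_rfl, Nat.sub_self,
      coeff_zero_eq_constantCoeff_apply, map_mul, map_mul, map_pow, hT, one_pow, mul_one,
      map_natCast, ← coeff_zero_eq_constantCoeff_apply, coeff_mk, zero_add]
  have hquad : coeff k (r * (X ^ k * mk fun i ↦ coeff (i + k) F) ^ 2) = 0 := by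
    rw [mul_pow, ← pow_mul, mul_left_comm, coeff_X_pow_mul', if_neg (by lia)]
  have h := congrArg (coeff k) hr
  rw [← hsplit, map_add, map_add, hlin, hquad, add_zero, ← Polynomial.coe_pow,
    Polynomial.coeff_coe] at h
  rw [h, add_sub_cancel_right]

/-- truncated-exponential coefficient identity.
Let `p` be a prime, `q = p²`, `k ≥ 1`, and
`S_{k−1}(y) = ∑_{ℓ=0}^{k−1} ((−1)^ℓ/(p^ℓ ℓ!)) y^ℓ` over `ℚ`.  Then
`[y^k] (S_{k−1}(y))^q = (−p)^k/k! − q·(−1)^k/(p^k k!)`. -/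
theorem stmt5 (p : ℕ) (hp : p.Prime) (k : ℕ) (hk : 1 ≤ k) :
    ((∑ ℓ ∈ Finset.range k,
        Polynomial.C ((-1 : ℚ) ^ ℓ / ((p : ℚ) ^ ℓ * (ℓ.factorial : ℚ))) * Polynomial.X ^ ℓ)
          ^ (p ^ 2)).coeff k
      = (-(p : ℚ)) ^ k / (k.factorial : ℚ)
        - (p : ℚ) ^ 2 * (-1 : ℚ) ^ k / ((p : ℚ) ^ k * (k.factorial : ℚ)) := by
  have hp0 : (p : ℚ) ≠ 0 := Nat.cast_ne_zero.2 hp.ne_zero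
  set F : PowerSeries ℚ := PowerSeries.rescale (-(p : ℚ)⁻¹) (PowerSeries.exp ℚ) with hF
  have hcoeff (ℓ : ℕ) :
      PowerSeries.coeff ℓ F = (-1 : ℚ) ^ ℓ / ((p : ℚ) ^ ℓ * (ℓ.factorial : ℚ)) := by
    rw [hF, PowerSeries.coeff_rescale, PowerSeries.coeff_exp, neg_pow, inv_pow]
    simp only [Algebra.algebraMap_self, RingHom.id_apply]
    field_simp
  have htrunc : ∑ ℓ ∈ Finset.range k,
      Polynomial.C ((-1 : ℚ) ^ ℓ / ((p : ℚ) ^ ℓ * (ℓ.factorial : ℚ))) * Polynomial.X ^ ℓ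
        = PowerSeries.trunc k F := by
    simp only [PowerSeries.trunc_apply, Nat.Ico_zero_eq_range, hcoeff,
      Polynomial.C_mul_X_pow_eq_monomial]
  have hpow : PowerSeries.coeff k (F ^ p ^ 2) = (-(p : ℚ)) ^ k / (k.factorial : ℚ) := by
    rw [hF, ← map_pow, PowerSeries.exp_pow_eq_rescale_exp, PowerSeries.coeff_rescale,
      PowerSeries.coeff_rescale, PowerSeries.coeff_exp, ← mul_assoc, ← mul_pow]
    have h : -(p : ℚ)⁻¹ * ((p ^ 2 : ℕ) : ℚ) = -p := by
      push_cast
      field_simp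
    rw [h]
    simp [div_eq_mul_inv]
  have hconst : PowerSeries.constantCoeff F = 1 := by
    rw [← PowerSeries.coeff_zero_eq_constantCoeff_apply, hcoeff]
    simp
  rw [htrunc, coeff_trunc_pow_self F hconst (by lia), hpow, hcoeff]
  push_cast
  ring
end

section
/- Let p be a prime, q = p², and m ≥ 1. Then the coefficient of y^m in (Σ_{i=0}^{m−1} y^i/(p^i·i!))^q equals p^m/m! − q/(p^m·m!). -/
/-- If `f` has constant coefficient `1`, dropping the terms of degree at least `m` from `f` lowers
the coefficient of `X ^ m` in `f ^ n` by `n` times that of `f`. -/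
theorem PowerSeries.coeff_trunc_pow {R : Type*} [CommRing R] {f : PowerSeries R}
    (hf : PowerSeries.constantCoeff f = 1) {m : ℕ} (hm : 1 ≤ m) (n : ℕ) :
    ((PowerSeries.trunc m f) ^ n).coeff m
      = PowerSeries.coeff m (f ^ n) - n * PowerSeries.coeff m f := by
  set S : PowerSeries R := ((PowerSeries.trunc m f : Polynomial R) : PowerSeries R) with hS
  have hS0 : PowerSeries.constantCoeff S = 1 := by
    rw [← PowerSeries.coeff_zero_eq_constantCoeff_apply, hS, Polynomial.coeff_coe,
      PowerSeries.coeff_trunc, if_pos (by omega),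
      PowerSeries.coeff_zero_eq_constantCoeff_apply, hf]
  obtain ⟨g, hg⟩ : PowerSeries.X ^ m ∣ f - S := by
    rw [PowerSeries.X_pow_dvd_iff]
    intro k hk
    rw [map_sub, hS, Polynomial.coeff_coe, PowerSeries.coeff_trunc, if_pos hk, sub_self]
  have coeff_X_pow_mul_self (h : PowerSeries R) :
      PowerSeries.coeff m (PowerSeries.X ^ m * h) = PowerSeries.constantCoeff h := by
    simp [PowerSeries.coeff_X_pow_mul']
  have hg0 : PowerSeries.constantCoeff g = PowerSeries.coeff m f := by
    rw [← coeff_X_pow_mul_self, ← hg, map_sub, hS, Polynomial.coeff_coe,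
      PowerSeries.coeff_trunc, if_neg (lt_irrefl m), sub_zero]
  have hpow : f ^ n - S ^ n
      = PowerSeries.X ^ m * (g * ∑ i ∈ Finset.range n, f ^ i * S ^ (n - 1 - i)) := by
    rw [← mul_assoc, ← hg, mul_comm, (Commute.all f S).geom_sum₂_mul]
  have hcoeff := congrArg (PowerSeries.coeff m) hpow
  rw [map_sub, coeff_X_pow_mul_self] at hcoeff
  simp only [map_mul, map_sum, map_pow, hf, hS0, hg0, one_pow, mul_one, Finset.sum_const,
    Finset.card_range, nsmul_eq_mul] at hcoeff
  rw [← Polynomial.coeff_coe, Polynomial.coe_pow, ← hS]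
  linear_combination -hcoeff

/-- truncated-exponential coefficient identity, positive form.
Let `p` be a prime, `q = p²`, `m ≥ 1`.  Then
`[y^m] (∑_{i=0}^{m−1} y^i/(p^i i!))^q = p^m/m! − q/(p^m m!)`. -/
theorem stmt6 (p : ℕ) (hp : p.Prime) (m : ℕ) (hm : 1 ≤ m) :
    ((∑ i ∈ Finset.range m,
        Polynomial.C (1 / ((p : ℚ) ^ i * (i.factorial : ℚ))) * Polynomial.X ^ i)
          ^ (p ^ 2)).coeff m
      = (p : ℚ) ^ m / (m.factorial : ℚ)
        - (p : ℚ) ^ 2 / ((p : ℚ) ^ m * (m.factorial : ℚ)) := by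
  have hp0 : (p : ℚ) ≠ 0 := Nat.cast_ne_zero.mpr hp.ne_zero
  let f : PowerSeries ℚ := PowerSeries.rescale (p : ℚ)⁻¹ (PowerSeries.exp ℚ)
  have hf (i : ℕ) : PowerSeries.coeff i f = 1 / ((p : ℚ) ^ i * (i.factorial : ℚ)) := by
    simp [f, PowerSeries.coeff_rescale, PowerSeries.coeff_exp, mul_comm]
  have htrunc : ∑ i ∈ Finset.range m,
      Polynomial.C (1 / ((p : ℚ) ^ i * (i.factorial : ℚ))) * Polynomial.X ^ i
        = PowerSeries.trunc m f := by
    ext k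
    simp only [Polynomial.finsetSum_coeff, Polynomial.coeff_C_mul_X_pow, PowerSeries.coeff_trunc,
      hf, Finset.sum_ite_eq, Finset.mem_range]
  have hf0 : PowerSeries.constantCoeff f = 1 := by
    rw [← PowerSeries.coeff_zero_eq_constantCoeff_apply, hf]
    simp
  have hfpow : PowerSeries.coeff m (f ^ p ^ 2) = (p : ℚ) ^ m / (m.factorial : ℚ) := by
    rw [← map_pow, PowerSeries.exp_pow_eq_rescale_exp, PowerSeries.coeff_rescale,
      PowerSeries.coeff_rescale, PowerSeries.coeff_exp, ← mul_assoc, ← mul_pow]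
    have hscale : (p : ℚ)⁻¹ * ((p ^ 2 : ℕ) : ℚ) = p := by
      push_cast
      field_simp
    rw [hscale]
    simp [div_eq_mul_inv]
  rw [htrunc, PowerSeries.coeff_trunc_pow hf0 hm, hfpow, hf]
  push_cast
  ring
end

section
/- Let p be an odd prime, q = p², and let k ≥ 1 with p | k. Let e = (e_0, e_1, ..., e_{k−1}) be nonnegative integers with Σ_n e_n = q and Σ_n n·e_n = k, and let γ_B(e) := (k!/q)·(q!/(∏_n e_n!))·∏_n (n!)^{−e_n} ∈ ℚ. If ord_p(γ_B(e)) = 0, then either e_0 = q−p, e_1 = p and all other e_n vanish, or else every index n ≥ 1 with e_n > 0 is divisible by p. -/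
/-- The product counting the symmetries of a set partition with `e n` blocks of size `n`
divides the factorial of the total size. -/
lemma prod_factorial_pow_mul_factorial_dvd (s : Finset ℕ) (hs : 0 ∉ s) (e : ℕ → ℕ) :
    (∏ n ∈ s, n.factorial ^ e n * (e n).factorial) ∣ (∑ n ∈ s, n * e n).factorial := by
  refine dvd_trans (Finset.prod_dvd_prod_of_dvd _ (fun n => (n * e n).factorial) fun n hn => ?_)
    (Nat.prod_factorial_dvd_factorial_sum s _)
  have hn0 : n ≠ 0 := fun h => hs (h ▸ hn)
  have h := Nat.uniformBell_mul_eq (e n) hn0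
  rw [mul_assoc] at h
  rw [mul_comm n, ← h]
  exact dvd_mul_left _ _

lemma prod_factorial_pow_dvd (s : Finset ℕ) (e : ℕ → ℕ) :
    (∏ n ∈ s, n.factorial ^ e n) ∣ (∑ n ∈ s, n * e n).factorial := by
  refine dvd_trans (Finset.prod_dvd_prod_of_dvd _ (fun n => (n * e n).factorial) fun n _ => ?_)
    (Nat.prod_factorial_dvd_factorial_sum s _)
  have h := Nat.prod_factorial_dvd_factorial_sum (Finset.range (e n)) (fun _ => n)
  simpa [mul_comm] using h

lemma Nat.Prime.dvd_choose_of_dvd_of_not_dvd {p k n : ℕ} (hp : p.Prime) (hpk : p ∣ k)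
    (hpn : ¬ p ∣ n) : p ∣ k.choose n := by
  rcases n with _ | n
  · exact absurd (dvd_zero p) hpn
  rcases k with _ | k
  · simp
  have h := Nat.add_one_mul_choose_eq k n
  exact (hp.dvd_mul.1 (h ▸ hpk.mul_right _ : p ∣ (k + 1).choose (n + 1) * (n + 1))).resolve_right hpn

/-- If the total size is divisible by `p` but some block size is not, the multinomial coefficient
is divisible by `p`. -/
lemma mul_prod_factorial_pow_dvd {p : ℕ} (hp : p.Prime) (s : Finset ℕ) (e : ℕ → ℕ)
    (hdvd : p ∣ ∑ n ∈ s, n * e n) {n : ℕ} (hn : n ∈ s) (hen : e n ≠ 0) (hpn : ¬ p ∣ n) :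
    p * (∏ m ∈ s, m.factorial ^ e m) ∣ (∑ m ∈ s, m * e m).factorial := by
  obtain ⟨a, ha⟩ := Nat.exists_eq_succ_of_ne_zero hen
  set k := ∑ m ∈ s, m * e m with hk
  have hsum : k = n + ∑ m ∈ s, m * Function.update e n a m := by
    rw [hk, ← Finset.add_sum_erase s _ hn, ← Finset.add_sum_erase s _ hn, ← add_assoc]
    congr 1
    · simp [ha, Nat.mul_succ, add_comm]
    · refine Finset.sum_congr rfl fun m hm => ?_
      rw [Function.update_of_ne (Finset.ne_of_mem_erase hm)]
  have hprod : ∏ m ∈ s, m.factorial ^ e m =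
      n.factorial * ∏ m ∈ s, m.factorial ^ Function.update e n a m := by
    rw [← Finset.mul_prod_erase s _ hn, ← Finset.mul_prod_erase s _ hn, ← mul_assoc]
    congr 1
    · simp [ha, pow_succ, mul_comm]
    · refine Finset.prod_congr rfl fun m hm => ?_
      rw [Function.update_of_ne (Finset.ne_of_mem_erase hm)]
  have hle : n ≤ k := by omega
  rw [← Nat.choose_mul_factorial_mul_factorial hle, hprod, mul_assoc]
  refine mul_dvd_mul (hp.dvd_choose_of_dvd_of_not_dvd hdvd hpn) (mul_dvd_mul_left _ ?_)
  have hrest : k - n = ∑ m ∈ s, m * Function.update e n a m := by omega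
  rw [hrest]
  exact prod_factorial_pow_dvd s _

lemma eq_one_of_sum_digits_le_one {p n : ℕ} (hp : 1 < p) (hpn : ¬ p ∣ n)
    (h : (p.digits n).sum ≤ 1) : n = 1 := by
  have hn : 0 < n := Nat.pos_of_ne_zero fun h0 => hpn (h0 ▸ dvd_zero p)
  have hmod : n % p ≠ 0 := fun h0 => hpn (Nat.dvd_of_mod_eq_zero h0)
  rw [Nat.digits_def' hp hn, List.sum_cons] at h
  have hdiv : n / p = 0 := by
    by_contra h0
    have hnil : p.digits (n / p) ≠ [] := Nat.digits_ne_nil_iff_ne_zero.mpr h0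
    have : 0 < (p.digits (n / p)).sum := List.sum_pos_iff_exists_pos_nat.mpr
      ⟨_, List.getLast_mem hnil, Nat.pos_of_ne_zero (Nat.getLast_digit_ne_zero p h0)⟩
    omega
  have := Nat.div_add_mod n p
  rw [hdiv] at this
  omega

/-- The number of partitions of a `p * n`-element set into `p` blocks of size `n` is prime to `p`
only when `n` is a power of `p`; here the case `p ∤ n`. -/
lemma eq_one_of_padicValNat_factorial_mul_le {p n : ℕ} [hp : Fact p.Prime] (hpn : ¬ p ∣ n)
    (h : padicValNat p (p * n).factorial ≤ padicValNat p (n.factorial ^ p * p.factorial)) :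
    n = 1 := by
  have hpfac : padicValNat p p.factorial = 1 := by
    simpa using padicValNat_factorial_mul (p := p) 1
  rw [padicValNat_factorial_mul, padicValNat.mul (by positivity) (by positivity), padicValNat.pow,
    hpfac] at h
  refine eq_one_of_sum_digits_le_one hp.out.one_lt hpn ?_
  have h1 := sub_one_mul_padicValNat_factorial (p := p) n
  have h2 := Nat.digit_sum_le p n
  rw [Nat.sub_mul, one_mul] at h1
  omega

lemma pow_two_mul_factorial_dvd {p a : ℕ} (ha : a < p ^ 2) :
    p ^ 2 * a.factorial ∣ (p ^ 2).factorial := by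
  rw [← Nat.mul_factorial_pred (n := p ^ 2) (by omega)]
  exact mul_dvd_mul_left _ (Nat.factorial_dvd_factorial (by omega))

lemma pow_three_mul_factorial_dvd {p a : ℕ} (hp : 0 < p) (ha : a + p < p ^ 2) :
    p ^ 3 * a.factorial ∣ (p ^ 2).factorial := by
  rw [← Nat.mul_factorial_pred (n := p ^ 2) (by omega), pow_succ, mul_assoc]
  refine mul_dvd_mul_left _ (dvd_trans ?_
    (Nat.factorial_dvd_factorial (show p ^ 2 - p ≤ p ^ 2 - 1 by omega)))
  rw [← Nat.mul_factorial_pred (n := p ^ 2 - p) (by omega)]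
  exact mul_dvd_mul (Nat.dvd_sub (dvd_pow_self p two_ne_zero) dvd_rfl)
    (Nat.factorial_dvd_factorial (by omega))

/-- structure of unit-coefficient `B`-term monomials.
Let `p` be an odd prime, `q = p²`, `k ≥ 1` with `p ∣ k`.  Let `e₀,…,e_{k−1} ≥ 0`
satisfy `∑ eₙ = q` and `∑ n·eₙ = k`, and let
`γ_B(e) = (k!/q)·(q!/∏ eₙ!)·∏ (n!)^{−eₙ}`.  If `ord_p(γ_B(e)) = 0`, then either
`e₀ = q−p`, `e₁ = p`, and all other `eₙ` vanish, or else every index `n ≥ 1` with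
`eₙ > 0` is divisible by `p`. -/
theorem stmt7 (p : ℕ) (hp : p.Prime) (hodd : Odd p) (k : ℕ) (hk : 1 ≤ k)
    (hpk : p ∣ k) (e : ℕ → ℕ) (he : ∀ n, k ≤ n → e n = 0)
    (hsum : ∑ n ∈ Finset.range k, e n = p ^ 2)
    (hwt : ∑ n ∈ Finset.range k, n * e n = k)
    (γ : ℚ)
    (hγ : γ = (k.factorial : ℚ) / (p : ℚ) ^ 2 *
        (((p ^ 2).factorial : ℚ) / ∏ n ∈ Finset.range k, ((e n).factorial : ℚ)) *
        ∏ n ∈ Finset.range k, (1 / ((n.factorial : ℚ)) ^ (e n)))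
    (hval : padicValRat p γ = 0) :
    (e 0 = p ^ 2 - p ∧ e 1 = p ∧ ∀ n, 2 ≤ n → n < k → e n = 0) ∨
    (∀ n, 1 ≤ n → n < k → 0 < e n → p ∣ n) := by
  have : Fact p.Prime := ⟨hp⟩
  have hp0 := hp.pos
  set s := (Finset.range k).erase 0 with hs
  have h0k : 0 ∈ Finset.range k := Finset.mem_range.2 hk
  have h0s : 0 ∉ s := Finset.notMem_erase _ _
  rw [← Finset.add_sum_erase _ _ h0k, ← hs] at hsum hwt
  rw [zero_mul, zero_add] at hwt
  set X := ∏ n ∈ s, n.factorial ^ e n * (e n).factorial with hX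
  have hX0 : X ≠ 0 := Finset.prod_ne_zero_iff.2 fun n _ => by positivity
  have hγX : γ * (p ^ 2 * (e 0).factorial * X : ℕ) = (k.factorial * (p ^ 2).factorial : ℕ) := by
    have hA : ∏ n ∈ s, ((e n).factorial : ℚ) ≠ 0 :=
      Finset.prod_ne_zero_iff.2 fun n _ => by positivity
    have hB : ∏ n ∈ s, (n.factorial : ℚ) ^ e n ≠ 0 :=
      Finset.prod_ne_zero_iff.2 fun n _ => by positivity
    rw [hγ, ← Finset.mul_prod_erase _ _ h0k, ← Finset.mul_prod_erase _ _ h0k, ← hs, hX]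
    simp only [one_div, Finset.prod_inv_distrib]
    push_cast
    rw [Finset.prod_mul_distrib]
    have hpQ : (p : ℚ) ≠ 0 := by positivity
    have hE : ((e 0).factorial : ℚ) ≠ 0 := by positivity
    simp only [Nat.factorial_zero, Nat.cast_one, one_pow, inv_one, one_mul]
    field_simp
  have hγ0 : γ ≠ 0 := by
    rintro rfl
    rw [zero_mul] at hγX
    have : k.factorial * (p ^ 2).factorial ≠ 0 := by positivity
    exact this (by exact_mod_cast hγX.symm)
  have hv : padicValNat p k.factorial + padicValNat p (p ^ 2).factorial =
      padicValNat p (p ^ 2 * (e 0).factorial) + padicValNat p X := by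
    have h := congrArg (padicValRat p) hγX
    have hpe : p ^ 2 * (e 0).factorial ≠ 0 := by positivity
    rw [padicValRat.mul hγ0 (by exact_mod_cast mul_ne_zero hpe hX0), hval, zero_add,
      padicValRat.of_nat, padicValRat.of_nat, padicValNat.mul hpe hX0,
      padicValNat.mul k.factorial_ne_zero (p ^ 2).factorial_ne_zero] at h
    exact_mod_cast h.symm
  have hmono {a b : ℕ} (hb : b ≠ 0) (hab : a ∣ b) : padicValNat p a ≤ padicValNat p b :=
    (padicValNat_dvd_iff_le hb).1 (pow_padicValNat_dvd.trans hab)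
  have hXk : padicValNat p X ≤ padicValNat p k.factorial := by
    refine hmono (by positivity) ?_
    have h := prod_factorial_pow_mul_factorial_dvd s h0s e
    rwa [hwt] at h
  have he0 : p ^ 2 ≤ e 0 + p := by
    by_contra! h
    have h1 := hmono (by positivity) (pow_three_mul_factorial_dvd hp0 h)
    rw [pow_succ, mul_right_comm, padicValNat.mul (by positivity) hp0.ne', padicValNat_self] at h1
    omega
  have hlt : e 0 < p ^ 2 := by
    by_contra! h
    have h1 : ∑ n ∈ s, e n = 0 := by omega
    have h2 : ∑ n ∈ s, n * e n = 0 := Finset.sum_eq_zero fun n hn => by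
      rw [Finset.sum_eq_zero_iff.1 h1 n hn, mul_zero]
    omega
  have hkX : padicValNat p k.factorial ≤ padicValNat p X := by
    have h1 := hmono (by positivity) (pow_two_mul_factorial_dvd hlt)
    omega
  by_cases hall : ∀ n, 1 ≤ n → n < k → 0 < e n → p ∣ n
  · exact Or.inr hall
  left
  push Not at hall
  obtain ⟨n, hn1, hnk, hen, hpn⟩ := hall
  have hns : n ∈ s := by simp [hs]; omega
  by_cases hbig : ∃ m ∈ s, p ≤ e m
  · obtain ⟨m, hms, hpm⟩ := hbig
    have hsplit := Finset.add_sum_erase s e hms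
    have hem : e m = p := by omega
    have hrest : ∀ j ∈ s, j ≠ m → e j = 0 := fun j hj hjm =>
      Finset.sum_eq_zero_iff.1 (show ∑ j ∈ s.erase m, e j = 0 by omega) j
        (Finset.mem_erase.2 ⟨hjm, hj⟩)
    obtain rfl : n = m := by
      by_contra h
      exact hen.ne' (hrest n hns h)
    have hkn : k = p * n := by
      rw [← hwt, Finset.sum_eq_single_of_mem n hns fun j hj hjn => by rw [hrest j hj hjn, mul_zero],
        hem, mul_comm]
    have hXn : X = n.factorial ^ p * p.factorial := by
      rw [hX, Finset.prod_eq_single_of_mem n hns fun j hj hjn => by simp [hrest j hj hjn], hem]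
    obtain rfl : n = 1 := eq_one_of_padicValNat_factorial_mul_le hpn (by rwa [← hkn, ← hXn])
    refine ⟨by omega, hem, fun j hj hjk => hrest j ?_ (by omega)⟩
    simp [hs]; omega
  · push Not at hbig
    exfalso
    have hF : ¬ p ∣ ∏ m ∈ s, (e m).factorial := by
      rw [hp.prime.dvd_finsetProd_iff]
      rintro ⟨m, hm, h⟩
      exact absurd (hp.dvd_factorial.1 h) (hbig m hm).not_ge
    have hP0 : ∏ m ∈ s, m.factorial ^ e m ≠ 0 := Finset.prod_ne_zero_iff.2 fun m _ => by positivity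
    have hF0 : ∏ m ∈ s, (e m).factorial ≠ 0 := Finset.prod_ne_zero_iff.2 fun m _ => by positivity
    have h := mul_prod_factorial_pow_dvd hp s e (hwt.symm ▸ hpk) hns hen.ne' hpn
    rw [hwt] at h
    have h1 := hmono (by positivity) h
    rw [padicValNat.mul hp0.ne' hP0, padicValNat_self] at h1
    rw [hX, Finset.prod_mul_distrib, padicValNat.mul hP0 hF0,
      padicValNat.eq_zero_of_not_dvd hF] at hkX
    omega
end

section
/- Let p be an odd prime and, for n ≥ 2, set α_n := (p^n)! / (p²·(p^{n−2})!) ∈ ℚ. Then ord_p(α_n) = (p+1)·p^{n−2} − 2, and the unit part satisfies p^{−ord_p(α_n)}·α_n ≡ 1 (mod p). -/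
theorem exists_factorial_prime_mul_eq (p : ℕ) [hp : Fact p.Prime] (m : ℕ) :
    ∃ u : ℕ, (p * m).factorial = p ^ m * m.factorial * u ∧ (u : ZMod p) = (-1) ^ m := by
  induction m with
  | zero => exact ⟨1, by simp, by simp⟩
  | succ m ih =>
    obtain ⟨u, hu, hu'⟩ := ih
    refine ⟨u * (p * m + 1).ascFactorial (p - 1), ?_, ?_⟩
    · have h : p * (m + 1) = (p * m + (p - 1)) + 1 := by
        have := hp.out.one_lt
        rw [mul_add]
        omega
      rw [h, Nat.factorial_succ, ← h, ← Nat.factorial_mul_ascFactorial, hu, Nat.factorial_succ]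
      ring
    · have h : ((p * m + 1).ascFactorial (p - 1) : ZMod p) = -1 := by
        rw [← ZMod.wilsons_lemma p, ← Nat.one_ascFactorial (p - 1),
          Nat.ascFactorial_eq_prod_range, Nat.ascFactorial_eq_prod_range]
        simp
      rw [Nat.cast_mul, hu', h, pow_succ]

/-- the `A`-term constant `α_n`.
Let `p` be an odd prime and, for `n ≥ 2`, `α_n = (p^n)! / (p²·(p^{n−2})!)`.
Then `ord_p(α_n) = (p+1)·p^{n−2} − 2`, and the unit part satisfies
`p^{−ord_p(α_n)}·α_n ≡ 1 (mod p)` (expressed in `ℚ_p`). -/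
theorem stmt11 (p : ℕ) [Fact p.Prime] (hodd : Odd p) (n : ℕ) (hn : 2 ≤ n)
    (α : ℚ)
    (hα : α = (((p ^ n).factorial : ℚ)) / ((p : ℚ) ^ 2 * ((p ^ (n - 2)).factorial : ℚ))) :
    padicValRat p α = ((p : ℤ) + 1) * (p : ℤ) ^ (n - 2) - 2 ∧
    ‖(p : ℚ_[p]) ^ (-(((p : ℤ) + 1) * (p : ℤ) ^ (n - 2) - 2)) * (α : ℚ_[p]) - 1‖
      ≤ (p : ℝ)⁻¹ := by
  have hp : p.Prime := Fact.out
  obtain ⟨k, rfl⟩ := Nat.exists_eq_add_of_le' hn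
  rw [Nat.add_sub_cancel] at *
  obtain ⟨u, hu, hu'⟩ := exists_factorial_prime_mul_eq p (p ^ k)
  obtain ⟨v, hv, hv'⟩ := exists_factorial_prime_mul_eq p (p ^ (k + 1))
  rw [← pow_succ'] at hu hv
  rw [hodd.pow.neg_one_pow] at hu' hv'
  have hw : ((u * v : ℕ) : ZMod p) = 1 := by
    rw [Nat.cast_mul, hu', hv', neg_one_mul, neg_neg]
  have hp0 : (p : ℚ) ≠ 0 := mod_cast hp.ne_zero
  have hα' : α = (p : ℚ) ^ (((p : ℤ) + 1) * (p : ℤ) ^ k - 2) * ((u * v : ℕ) : ℚ) := by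
    have he : ((p : ℤ) + 1) * (p : ℤ) ^ k = ((p ^ (k + 1) + p ^ k : ℕ) : ℤ) := by
      push_cast
      ring
    have hf : ((p ^ k).factorial : ℚ) ≠ 0 := mod_cast Nat.factorial_ne_zero _
    rw [hα, hv, hu, he, zpow_sub₀ hp0, zpow_natCast, zpow_ofNat]
    push_cast
    field_simp
    ring
  have hndvd : ¬ p ∣ u * v := by
    rw [← ZMod.natCast_eq_zero_iff, hw]
    exact one_ne_zero
  have hw0 : ((u * v : ℕ) : ℚ) ≠ 0 := by
    intro h
    exact hndvd (by rw [Nat.cast_eq_zero.mp h]; exact dvd_zero p)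
  constructor
  · rw [hα', padicValRat.mul (zpow_ne_zero _ hp0) hw0, padicValRat.zpow,
      padicValRat.self hp.one_lt, padicValRat.of_nat,
      padicValNat.eq_zero_of_not_dvd hndvd]
    simp
  · have hp0' : (p : ℚ_[p]) ≠ 0 := mod_cast hp.ne_zero
    have hd : ((p ^ 1 : ℕ) : ℤ) ∣ ((u * v : ℕ) : ℤ) - 1 := by
      rw [pow_one, ← ZMod.intCast_zmod_eq_zero_iff_dvd, Int.cast_sub, Int.cast_natCast, hw]
      simp
    have h := (Padic.norm_int_le_pow_iff_dvd (p := p) _ 1).mpr (mod_cast hd)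
    rw [hα', Rat.cast_mul, Rat.cast_zpow, Rat.cast_natCast, Rat.cast_natCast, ← mul_assoc,
      ← zpow_add₀ hp0', neg_add_cancel, zpow_zero, one_mul]
    simpa using h
end

section
/- Let p be an odd prime and, for n ≥ 1, set γ_n := ((p^n)! / (p·((p^{n−1})!)^p)) · binom(p²−1, p−1) ∈ ℚ. Then ord_p(γ_n) = 0 and γ_n ≡ −1 (mod p). -/
theorem exists_factorial_mul_prime_eq (p : ℕ) [Fact p.Prime] (m : ℕ) :
    ∃ u : ℕ, (m * p).factorial = p ^ m * m.factorial * u ∧ (u : ZMod p) = (-1) ^ m := by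
  have hp : p - 1 + 1 = p := Nat.sub_add_cancel (Fact.out : p.Prime).one_le
  induction m with
  | zero => exact ⟨1, by simp, by simp⟩
  | succ m ih =>
    obtain ⟨u, hu, hu'⟩ := ih
    refine ⟨u * (m * p + 1).ascFactorial (p - 1), ?_, ?_⟩
    · have h : ((m + 1) * p).factorial =
          (m * p + (p - 1) + 1) * (m * p + (p - 1)).factorial := by
        rw [← Nat.factorial_succ, add_assoc, hp, Nat.succ_mul]
      rw [h, ← Nat.factorial_mul_ascFactorial, hu, add_assoc, hp, Nat.factorial_succ]
      ring
    · rw [Nat.cast_mul, hu', pow_succ, Nat.ascFactorial_eq_prod_range, ← ZMod.wilsons_lemma p,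
        Nat.factorial_eq_prod_range_add_one]
      push_cast
      simp [add_comm]

theorem exists_factorial_prime_pow_eq (p : ℕ) [Fact p.Prime] (hodd : Odd p) (n : ℕ) :
    ∃ u : ℕ, (p ^ n).factorial = p ^ (∑ i ∈ Finset.range n, p ^ i) * u ∧
      (u : ZMod p) = (-1) ^ n := by
  induction n with
  | zero => exact ⟨1, by simp, by simp⟩
  | succ n ih =>
    obtain ⟨u, hu, hu'⟩ := ih
    obtain ⟨v, hv, hv'⟩ := exists_factorial_mul_prime_eq p (p ^ n)
    refine ⟨u * v, ?_, ?_⟩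
    · rw [pow_succ, hv, hu, Finset.sum_range_succ, pow_add]
      ring
    · rw [Nat.cast_mul, hu', hv', hodd.pow.neg_one_pow, pow_succ]

theorem choose_prime_sq_sub_one_cast (p : ℕ) [Fact p.Prime] :
    (((p ^ 2 - 1).choose (p - 1) : ℕ) : ZMod p) = 1 := by
  have hp : 0 < p := (Fact.out : p.Prime).pos
  have hlt : p - 1 < p := Nat.sub_lt hp one_pos
  have h : p ^ 2 - 1 = p - 1 + p * (p - 1) := by
    obtain ⟨q, rfl⟩ : ∃ q, p = q + 1 := ⟨p - 1, by omega⟩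
    simp only [Nat.add_sub_cancel]
    rw [Nat.sub_eq_iff_eq_add (Nat.one_le_pow _ _ hp)]
    ring
  have hmod := (ZMod.natCast_eq_natCast_iff _ _ p).2
    (Choose.choose_modEq_choose_mod_mul_choose_div_nat (p := p) (n := p ^ 2 - 1) (k := p - 1))
  rw [hmod, h, Nat.add_mul_mod_self_left, Nat.mod_eq_of_lt hlt, Nat.div_eq_of_lt hlt]
  simp

/-- the exceptional `B`-term constant `γ_n`.
Let `p` be an odd prime and, for `n ≥ 1`,
`γ_n = ((p^n)! / (p·((p^{n−1})!)^p)) · binom(p²−1, p−1)`.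
Then `ord_p(γ_n) = 0` and `γ_n ≡ −1 (mod p)` (expressed in `ℚ_p`). -/
theorem stmt12 (p : ℕ) [Fact p.Prime] (hodd : Odd p) (n : ℕ) (hn : 1 ≤ n)
    (γ : ℚ)
    (hγ : γ = (((p ^ n).factorial : ℚ)) / ((p : ℚ) * ((p ^ (n - 1)).factorial : ℚ) ^ p) *
        ((p ^ 2 - 1).choose (p - 1) : ℚ)) :
    padicValRat p γ = 0 ∧ ‖(γ : ℚ_[p]) + 1‖ ≤ (p : ℝ)⁻¹ := by
  have hp0 : (p : ℚ) ≠ 0 := Nat.cast_ne_zero.2 (Fact.out : p.Prime).ne_zero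
  obtain ⟨n, rfl⟩ : ∃ m, n = m + 1 := ⟨n - 1, by omega⟩
  obtain ⟨a, ha, ha'⟩ := exists_factorial_prime_pow_eq p hodd (n + 1)
  obtain ⟨b, hb, hb'⟩ := exists_factorial_prime_pow_eq p hodd n
  have hc' := choose_prime_sq_sub_one_cast p
  rw [Nat.add_sub_cancel, ha, hb] at hγ
  generalize (p ^ 2 - 1).choose (p - 1) = c at hγ hc'
  have hexp : ∑ i ∈ Finset.range (n + 1), p ^ i = (∑ i ∈ Finset.range n, p ^ i) * p + 1 := by
    rw [Finset.sum_range_succ', Finset.sum_mul]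
    simp [pow_succ]
  have hbp : ¬ p ∣ b ^ p := by
    rw [← ZMod.natCast_eq_zero_iff, Nat.cast_pow, hb']
    simp
  have hac : ¬ p ∣ a * c := by
    rw [← ZMod.natCast_eq_zero_iff, Nat.cast_mul, ha', hc']
    simp
  have hsum : p ∣ a * c + b ^ p := by
    rw [← ZMod.natCast_eq_zero_iff, Nat.cast_add, Nat.cast_mul, Nat.cast_pow, ha', hb', hc',
      ← pow_mul, mul_comm n p, pow_mul, hodd.neg_one_pow]
    ring
  have hbp0 : b ^ p ≠ 0 := fun h => hbp (h ▸ dvd_zero p)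
  have hac0 : a * c ≠ 0 := fun h => hac (h ▸ dvd_zero p)
  have hγ' : γ = ((a * c : ℕ) : ℚ) / ((b ^ p : ℕ) : ℚ) := by
    have hbQ : (b : ℚ) ^ p ≠ 0 := by exact_mod_cast hbp0
    rw [hγ, hexp]
    push_cast
    rw [mul_pow, ← pow_mul, pow_succ]
    field_simp
  constructor
  · rw [hγ', padicValRat.div (Nat.cast_ne_zero.2 hac0) (Nat.cast_ne_zero.2 hbp0),
      padicValRat.of_nat, padicValRat.of_nat, padicValNat.eq_zero_of_not_dvd hac,
      padicValNat.eq_zero_of_not_dvd hbp]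
    simp
  · have hb0 : ((b ^ p : ℕ) : ℚ_[p]) ≠ 0 := Nat.cast_ne_zero.2 hbp0
    have hnorm : ‖((b ^ p : ℕ) : ℚ_[p])‖ = 1 := by
      rw [Padic.norm_natCast_eq_one_iff]
      exact (Nat.Prime.coprime_iff_not_dvd Fact.out).2 hbp
    have h : (γ : ℚ_[p]) + 1 = ((a * c + b ^ p : ℕ) : ℚ_[p]) / ((b ^ p : ℕ) : ℚ_[p]) := by
      rw [hγ', Rat.cast_div, Rat.cast_natCast, Rat.cast_natCast, Nat.cast_add (a * c), add_div,
        div_self hb0]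
    rw [h, norm_div, hnorm, div_one]
    obtain ⟨d, hd⟩ := hsum
    rw [hd, Nat.cast_mul, norm_mul, Padic.norm_p]
    exact mul_le_of_le_one_right (by positivity) (Padic.norm_int_le_one (d : ℤ))
end

section
/- Let p be an odd prime and r ≥ 1 an integer, and define a sequence of integers by v_0 = r, v_1 = p·r, and for n ≥ 2, v_n = min{A_n, B_n} where A_n := (p+1)·p^{n−2} − 2 + v_{n−2} and B_n := p·v_{n−1}. Then: (1) for every j ≥ 1 one has B_{2j+1} < A_{2j+1}, so v_{2j+1} = p·v_{2j}; (2) for every j ≥ 1 one has A_{2j} < B_{2j} if and only if r ≥ 2j−1; (3) for every n ≥ 2·⌊(r+1)/2⌋ + 1 one has v_n = p·v_{n−1}. -/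
/-- The sequence `v_n` defined by `v₀ = r`, `v₁ = p·r`, and for `n ≥ 2`
`v_n = min{A_n, B_n}` with `A_n = (p+1)·p^{n−2} − 2 + v_{n−2}` and
`B_n = p·v_{n−1}`. -/
def Vmin (p r : ℕ) : ℕ → ℤ
  | 0 => (r : ℤ)
  | 1 => (p : ℤ) * (r : ℤ)
  | n + 2 => min (((p : ℤ) + 1) * (p : ℤ) ^ n - 2 + Vmin p r n) ((p : ℤ) * Vmin p r (n + 1))

theorem Vmin_add_two (p r n : ℕ) :
    Vmin p r (n + 2) =
      min (((p : ℤ) + 1) * (p : ℤ) ^ n - 2 + Vmin p r n) ((p : ℤ) * Vmin p r (n + 1)) := rfl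

theorem mul_Vmin_lt_of_odd_eq {p r j : ℕ} (hp : 2 ≤ p)
    (h : Vmin p r (2 * j + 1) = (p : ℤ) * Vmin p r (2 * j)) :
    (p : ℤ) * Vmin p r (2 * j + 2) <
      ((p : ℤ) + 1) * (p : ℤ) ^ (2 * j + 1) - 2 + Vmin p r (2 * j + 1) := by
  have hp' : (2 : ℤ) ≤ p := by exact_mod_cast hp
  have hle : Vmin p r (2 * j + 2) ≤ ((p : ℤ) + 1) * (p : ℤ) ^ (2 * j) - 2 + Vmin p r (2 * j) :=
    min_le_left _ _
  have hmul := mul_le_mul_of_nonneg_left hle (by linarith : (0 : ℤ) ≤ p)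
  rw [h, pow_succ]
  linarith

theorem Vmin_odd {p : ℕ} (hp : 2 ≤ p) (r j : ℕ) :
    Vmin p r (2 * j + 1) = (p : ℤ) * Vmin p r (2 * j) := by
  induction j with
  | zero => rfl
  | succ j ih =>
    exact (Vmin_add_two p r (2 * j + 1)).trans (min_eq_right (mul_Vmin_lt_of_odd_eq hp ih).le)

/-- The even-indexed terms satisfy a closed formula as long as `2 * j ≤ r + 1`, and an upper
bound as soon as `r ≤ 2 * j`. -/
theorem Vmin_even {p : ℕ} (hp : 2 ≤ p) (r j : ℕ) :
    (2 * j ≤ r + 1 → ((p : ℤ) ^ 2 - 1) * Vmin p r (2 * j) =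
      ((p : ℤ) ^ 2 - 1) * ((r : ℤ) - 2 * j) + ((p : ℤ) + 1) * ((p : ℤ) ^ (2 * j) - 1)) ∧
    (r ≤ 2 * j → ((p : ℤ) ^ 2 - 1) * Vmin p r (2 * j) ≤
      ((p : ℤ) + 1) * (p : ℤ) ^ (2 * j) - 2) := by
  have hp' : (2 : ℤ) ≤ p := by exact_mod_cast hp
  have bound_of_formula (k : ℕ) (hk : r ≤ 2 * k) (h : ((p : ℤ) ^ 2 - 1) * Vmin p r (2 * k) =
      ((p : ℤ) ^ 2 - 1) * ((r : ℤ) - 2 * k) + ((p : ℤ) + 1) * ((p : ℤ) ^ (2 * k) - 1)) :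
      ((p : ℤ) ^ 2 - 1) * Vmin p r (2 * k) ≤ ((p : ℤ) + 1) * (p : ℤ) ^ (2 * k) - 2 := by
    have hk' : (r : ℤ) - 2 * k ≤ 0 := by
      have : (r : ℤ) ≤ 2 * k := by exact_mod_cast hk
      linarith
    have := mul_nonpos_of_nonneg_of_nonpos (by nlinarith : (0 : ℤ) ≤ (p : ℤ) ^ 2 - 1) hk'
    linarith
  induction j with
  | zero => exact ⟨fun _ => by simp [Vmin], fun h => bound_of_formula 0 h (by simp [Vmin])⟩
  | succ j ih =>
    have hrec := Vmin_add_two p r (2 * j)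
    rw [Vmin_odd hp] at hrec
    have formula (hj : 2 * (j + 1) ≤ r + 1) : ((p : ℤ) ^ 2 - 1) * Vmin p r (2 * (j + 1)) =
        ((p : ℤ) ^ 2 - 1) * ((r : ℤ) - 2 * (j + 1 : ℕ)) +
          ((p : ℤ) + 1) * ((p : ℤ) ^ (2 * (j + 1)) - 1) := by
      have ihf := ih.1 (by omega)
      have hr : (1 : ℤ) ≤ (r : ℤ) - 2 * j := by
        have : 2 * (j : ℤ) + 1 ≤ r := by exact_mod_cast (by omega : 2 * j + 1 ≤ r)
        linarith
      have hmul := mul_le_mul_of_nonneg_left hr (by nlinarith : (0 : ℤ) ≤ (p : ℤ) ^ 2 - 1)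
      rw [min_eq_left (by nlinarith)] at hrec
      rw [mul_add, mul_one, hrec, pow_add]
      push_cast
      linear_combination ihf
    refine ⟨formula, fun hr => ?_⟩
    by_cases hj : 2 * (j + 1) ≤ r + 1
    · exact bound_of_formula _ hr (formula hj)
    · have hbound := ih.2 (by omega)
      have hle : Vmin p r (2 * j + 2) ≤ (p : ℤ) * ((p : ℤ) * Vmin p r (2 * j)) :=
        hrec.trans_le (min_le_right _ _)
      have h1 := mul_le_mul_of_nonneg_left hle (by nlinarith : (0 : ℤ) ≤ (p : ℤ) ^ 2 - 1)
      have h2 := mul_le_mul_of_nonneg_left hbound (sq_nonneg (p : ℤ))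
      rw [mul_add, mul_one, pow_add]
      nlinarith

theorem Vmin_even_branch_iff {p : ℕ} (hp : 2 ≤ p) (r j : ℕ) :
    ((p : ℤ) + 1) * (p : ℤ) ^ (2 * j) - 2 + Vmin p r (2 * j) <
      (p : ℤ) * Vmin p r (2 * j + 1) ↔ 2 * j + 1 ≤ r := by
  have hp' : (2 : ℤ) ≤ p := by exact_mod_cast hp
  obtain ⟨hformula, hbound⟩ := Vmin_even hp r j
  rw [Vmin_odd hp]
  constructor
  · intro h
    by_contra hr
    have := hbound (by omega)
    linarith
  · intro h
    have hf := hformula (by omega)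
    have hr : (1 : ℤ) ≤ (r : ℤ) - 2 * j := by
      have : 2 * (j : ℤ) + 1 ≤ r := by exact_mod_cast h
      linarith
    have hmul := mul_le_mul_of_nonneg_left hr (by nlinarith : (0 : ℤ) ≤ (p : ℤ) ^ 2 - 1)
    nlinarith

/-- pure-power branch pattern.
With the above recursion: (1) every odd layer `n = 2j+1` (`j ≥ 1`) is
`B`-dominated, i.e. `B_{2j+1} < A_{2j+1}` and `v_{2j+1} = p·v_{2j}`;
(2) an even layer `n = 2j` (`j ≥ 1`) is `A`-dominated, i.e. `A_{2j} < B_{2j}`,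
if and only if `r ≥ 2j−1`; (3) for every `n ≥ 2·⌊(r+1)/2⌋ + 1` one has
`v_n = p·v_{n−1}`. -/
theorem stmt16 (p : ℕ) (hp : p.Prime) (hodd : Odd p) (r : ℕ) (hr : 1 ≤ r) :
    (∀ j : ℕ, 1 ≤ j →
      (p : ℤ) * Vmin p r (2 * j) <
          ((p : ℤ) + 1) * (p : ℤ) ^ (2 * j - 1) - 2 + Vmin p r (2 * j - 1) ∧
      Vmin p r (2 * j + 1) = (p : ℤ) * Vmin p r (2 * j)) ∧
    (∀ j : ℕ, 1 ≤ j →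
      (((p : ℤ) + 1) * (p : ℤ) ^ (2 * j - 2) - 2 + Vmin p r (2 * j - 2) <
          (p : ℤ) * Vmin p r (2 * j - 1) ↔ 2 * j - 1 ≤ r)) ∧
    (∀ n : ℕ, 2 * ((r + 1) / 2) + 1 ≤ n →
      Vmin p r n = (p : ℤ) * Vmin p r (n - 1)) := by
  have hp2 := hp.two_le
  refine ⟨fun j hj => ?_, fun j hj => ?_, fun n hn => ?_⟩
  · obtain ⟨k, rfl⟩ := Nat.exists_eq_add_of_le' hj
    exact ⟨mul_Vmin_lt_of_odd_eq hp2 (Vmin_odd hp2 r k), Vmin_odd hp2 r (k + 1)⟩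
  · obtain ⟨k, rfl⟩ := Nat.exists_eq_add_of_le' hj
    exact Vmin_even_branch_iff hp2 r k
  · obtain ⟨m, rfl | rfl⟩ := Nat.even_or_odd' n
    · obtain ⟨k, rfl⟩ := Nat.exists_eq_add_of_le' (by omega : 1 ≤ m)
      refine (Vmin_add_two p r (2 * k)).trans (min_eq_right (not_lt.mp fun h => ?_))
      have := (Vmin_even_branch_iff hp2 r k).mp h
      omega
    · exact Vmin_odd hp2 r m
end

section
/- Let p be an odd prime and r ≥ 1 an integer, and define a sequence of integers by v_0 = r, v_1 = p·r, and for n ≥ 2, v_n = min{(p+1)·p^{n−2} − 2 + v_{n−2}, p·v_{n−1}}. Set s := ⌊(r+1)/2⌋. Then for every n ≥ 2s one has (p−1)·v_n = p^n − p^{n−r} (note n ≥ 2s ≥ r, so p^{n−r} is an integer); equivalently v_n = ((1 − p^{−r})/(p−1))·p^n. -/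
/-- In the initial range, the first branch of the minimum is taken at even indices and the second
one at odd indices. -/
theorem Vmin_even_and_odd {p r : ℕ} (hp : 2 ≤ p) (k : ℕ) (hk : 2 * k ≤ r + 1) :
    ((p : ℤ) - 1) * Vmin p r (2 * k) = (p : ℤ) ^ (2 * k) - 1 + ((p : ℤ) - 1) * (r - 2 * k) ∧
      Vmin p r (2 * k + 1) = p * Vmin p r (2 * k) := by
  have hp' : (2 : ℤ) ≤ p := by exact_mod_cast hp
  induction k with
  | zero => simp [Vmin]
  | succ k ih =>
    obtain ⟨heven, hodd⟩ := ih (by omega)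
    have hkr : (1 : ℤ) ≤ r - 2 * k := by omega
    have hstep : Vmin p r (2 * k + 2) =
        ((p : ℤ) + 1) * (p : ℤ) ^ (2 * k) - 2 + Vmin p r (2 * k) := by
      rw [Vmin_add_two, hodd]
      refine min_eq_left ?_
      have hmul : ((p : ℤ) - 1) * 1 ≤ ((p : ℤ) - 1) * (r - 2 * k) :=
        mul_le_mul_of_nonneg_left hkr (by linarith)
      nlinarith
    refine ⟨?_, ?_⟩
    · rw [show 2 * (k + 1) = 2 * k + 2 by ring, hstep]
      push_cast
      linear_combination heven
    · rw [show 2 * (k + 1) + 1 = (2 * k + 1) + 2 by ring, Vmin_add_two,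
        show 2 * k + 1 + 1 = 2 * k + 2 by ring, show 2 * (k + 1) = 2 * k + 2 by ring]
      refine min_eq_right ?_
      rw [hstep, hodd, pow_succ]
      linarith

/-- Once two consecutive terms have the pure-power form, all later terms do. -/
theorem Vmin_pure_power_of_two_terms {p r e : ℕ} (hp : 2 ≤ p)
    (h₀ : ((p : ℤ) - 1) * Vmin p r (r + e) = (p : ℤ) ^ (r + e) - (p : ℤ) ^ e)
    (h₁ : Vmin p r (r + e + 1) = p * Vmin p r (r + e)) (m : ℕ) :
    ((p : ℤ) - 1) * Vmin p r (r + e + m) = (p : ℤ) ^ (r + e + m) - (p : ℤ) ^ (e + m) := by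
  have hp' : (2 : ℤ) ≤ p := by exact_mod_cast hp
  induction m using Nat.twoStepInduction with
  | zero => simpa using h₀
  | one =>
    rw [h₁, pow_succ, pow_succ]
    linear_combination (p : ℤ) * h₀
  | more m ih₀ ih₁ =>
    have hbranch : (p : ℤ) * Vmin p r (r + e + m + 1) ≤
        ((p : ℤ) + 1) * (p : ℤ) ^ (r + e + m) - 2 + Vmin p r (r + e + m) := by
      have hpow : (1 : ℤ) ≤ (p : ℤ) ^ (e + m) := one_le_pow₀ (by linarith)
      refine le_of_mul_le_mul_left ?_ (show (0 : ℤ) < (p : ℤ) - 1 by linarith)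
      have hsq : ((p : ℤ) ^ 2 - 1) * 1 ≤ ((p : ℤ) ^ 2 - 1) * (p : ℤ) ^ (e + m) :=
        mul_le_mul_of_nonneg_left hpow (by nlinarith)
      rw [← add_assoc, ← add_assoc, pow_succ, pow_succ] at ih₁
      nlinarith
    rw [← add_assoc, ← add_assoc, Vmin_add_two, min_eq_right hbranch]
    rw [← add_assoc, ← add_assoc, pow_succ, pow_succ] at ih₁
    rw [pow_add _ _ 2, pow_add _ _ 2]
    linear_combination (p : ℤ) * ih₁

/-- stable pure-power slope.
With `s = ⌊(r+1)/2⌋`, for every `n ≥ 2s` one has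
`(p−1)·v_n = p^n − p^{n−r}`; equivalently `v_n = ((1 − p^{−r})/(p−1))·p^n`. -/
theorem stmt17 (p : ℕ) (hp : p.Prime) (hodd : Odd p) (r : ℕ) (hr : 1 ≤ r)
    (n : ℕ) (hn : 2 * ((r + 1) / 2) ≤ n) :
    ((p : ℤ) - 1) * Vmin p r n = (p : ℤ) ^ n - (p : ℤ) ^ (n - r) := by
  have hs := Vmin_even_and_odd (r := r) hp.two_le ((r + 1) / 2) (by omega)
  obtain ⟨e, he, he_le⟩ : ∃ e, 2 * ((r + 1) / 2) = r + e ∧ e ≤ 1 :=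
    ⟨2 * ((r + 1) / 2) - r, by omega, by omega⟩
  have hcast : (2 : ℤ) * (((r + 1) / 2 : ℕ) : ℤ) = r + e := by exact_mod_cast he
  rw [hcast, he] at hs
  obtain ⟨m, rfl⟩ := Nat.exists_eq_add_of_le (he ▸ hn)
  rw [show r + e + m - r = e + m by omega]
  refine Vmin_pure_power_of_two_terms hp.two_le ?_ hs.2 m
  rw [hs.1]
  interval_cases e <;> simp
end

section
/- Let p be an odd prime and let v : ℕ → ℕ be a sequence of nonnegative integers satisfying v_{i+1} ≤ p·v_i for all i ≥ 0. For a nonnegative integer k with base-p expansion k = Σ_i k_i·p^i, define Λ(k) := Σ_i k_i·v_i. Then Λ(m+n) ≤ Λ(m) + Λ(n) for all m, n ≥ 0, and more generally Λ(n_1 + ... + n_t) ≤ Λ(n_1) + ... + Λ(n_t) for every finite list of nonnegative integers n_1, ..., n_t. -/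
/-- Summation by parts for a partial digit weight: the digit sum is `k * v 0` minus a nonnegative
combination of the quotients `k / p ^ (i + 1)`, with a boundary term. -/
theorem sum_digit_mul_add_sum_div_mul (p : ℕ) (v : ℕ → ℕ) (hv : ∀ i, v (i + 1) ≤ p * v i)
    (k N : ℕ) :
    ∑ i ∈ Finset.range N, (k / p ^ i % p) * v i
      + ∑ i ∈ Finset.range N, (k / p ^ (i + 1)) * (p * v i - v (i + 1))
      + k / p ^ N * v N = k * v 0 := by
  induction N with
  | zero => simp
  | succ N ih =>
    rw [Finset.sum_range_succ, Finset.sum_range_succ, ← ih]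
    obtain ⟨w, hw⟩ := Nat.exists_eq_add_of_le (hv N)
    have hdiv : k / p ^ N = p * (k / p ^ (N + 1)) + k / p ^ N % p := by
      rw [pow_succ, ← Nat.div_div_eq_div_mul, Nat.div_add_mod]
    have hsub : p * v N - v (N + 1) = w := by omega
    rw [hsub]
    have hquot := congrArg (· * v N) hdiv
    have hweight := congrArg (k / p ^ (N + 1) * ·) hw
    linarith

/-- The partial digit weight is constant once every nonzero digit has been summed. -/
theorem sum_digit_mul_eq_of_lt {p : ℕ} (hp : 1 < p) (v : ℕ → ℕ) {k N : ℕ} (hN : k < N) :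
    ∑ i ∈ Finset.range (k + 1), (k / p ^ i % p) * v i
      = ∑ i ∈ Finset.range N, (k / p ^ i % p) * v i := by
  refine Finset.sum_subset (Finset.range_subset_range.2 hN) fun i _ hi => ?_
  have hki : k < i := by simpa using hi
  rw [Nat.div_eq_of_lt (hki.trans (Nat.lt_pow_self hp))]
  simp

/-- The partial digit weight, with all nonzero digits summed, is subadditive. -/
theorem sum_digit_mul_add_le {p : ℕ} (hp : 1 < p) (v : ℕ → ℕ) (hv : ∀ i, v (i + 1) ≤ p * v i)
    {m n N : ℕ} (hN : m + n < N) :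
    ∑ i ∈ Finset.range N, ((m + n) / p ^ i % p) * v i
      ≤ ∑ i ∈ Finset.range N, (m / p ^ i % p) * v i
        + ∑ i ∈ Finset.range N, (n / p ^ i % p) * v i := by
  have key (k : ℕ) (hk : k < N) :
      ∑ i ∈ Finset.range N, (k / p ^ i % p) * v i
        + ∑ i ∈ Finset.range N, (k / p ^ (i + 1)) * (p * v i - v (i + 1)) = k * v 0 := by
    have h := sum_digit_mul_add_sum_div_mul p v hv k N
    rwa [Nat.div_eq_of_lt (hk.trans (Nat.lt_pow_self hp)), zero_mul, add_zero] at h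
  have hfloor : ∑ i ∈ Finset.range N, (m / p ^ (i + 1)) * (p * v i - v (i + 1))
      + ∑ i ∈ Finset.range N, (n / p ^ (i + 1)) * (p * v i - v (i + 1))
      ≤ ∑ i ∈ Finset.range N, ((m + n) / p ^ (i + 1)) * (p * v i - v (i + 1)) := by
    rw [← Finset.sum_add_distrib]
    refine Finset.sum_le_sum fun i _ => ?_
    rw [← add_mul]
    exact Nat.mul_le_mul_right _ (Nat.div_add_div_le_add_div)
  linarith [key m (by omega), key n (by omega), key (m + n) hN, add_mul m n (v 0)]

/-- subadditivity of the digit weight.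
Let `p` be an odd prime and `v : ℕ → ℕ` satisfy `v_{i+1} ≤ p·vᵢ` for all `i`.
For `k` with base-`p` digits `kᵢ = k / pⁱ % p`, let `Λ(k) = ∑ᵢ kᵢ·vᵢ` (the sum
over `i ≤ k` suffices since higher digits vanish).  Then
`Λ(m+n) ≤ Λ(m) + Λ(n)` for all `m, n ≥ 0`, and more generally
`Λ(n₁ + ⋯ + n_t) ≤ Λ(n₁) + ⋯ + Λ(n_t)` for every finite list `n₁, …, n_t`. -/
theorem stmt18 (p : ℕ) (hp : p.Prime) (hodd : Odd p)
    (v : ℕ → ℕ) (hv : ∀ i, v (i + 1) ≤ p * v i)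
    (Λ : ℕ → ℕ)
    (hΛ : ∀ k, Λ k = ∑ i ∈ Finset.range (k + 1), (k / p ^ i % p) * v i) :
    (∀ m n : ℕ, Λ (m + n) ≤ Λ m + Λ n) ∧
    (∀ L : List ℕ, Λ L.sum ≤ (L.map Λ).sum) := by
  have hadd (m n : ℕ) : Λ (m + n) ≤ Λ m + Λ n := by
    rw [hΛ, hΛ m, hΛ n, sum_digit_mul_eq_of_lt hp.one_lt v (show m < m + n + 1 by omega),
      sum_digit_mul_eq_of_lt hp.one_lt v (show n < m + n + 1 by omega)]
    exact sum_digit_mul_add_le hp.one_lt v hv (Nat.lt_succ_self _)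
  refine ⟨hadd, fun L => ?_⟩
  induction L with
  | nil => simp [hΛ]
  | cons a L ih =>
    rw [List.sum_cons, List.map_cons, List.sum_cons]
    exact (hadd a L.sum).trans (Nat.add_le_add_left ih _)
end
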